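/- arXiv:2404.00099 — 2 statements merged into one kernel-verified Lean document; each statement's English description precedes it below -/
import Mathlib

section
/- In the MDP-with-data setup, let ζ* : S×A×S → ℝ be measurable with P( { s' : ζ*(s,a,s') ≤ 0 } | s,a ) = τ(s,a) for all (s,a), and define the Markov kernel P* by P*(ds'|s,a) := [ (1−λ(s,a)) + λ(s,a) τ(s,a)⁻¹ 1[ζ*(s,a,s') ≤ 0] ] · P(ds'|s,a). Let d* := d^{π,∞}_{d₁,P*} be the discounted state–action visitation distribution of π under P* started from d₁, suppose d* ≪ ν, and let w* := d d*/dν be bounded. Then for all bounded measurable q, β : S×A → ℝ (with v(s) := ∫ q(s,a) π(da|s)): (1−γ) ∫ v dd₁ + E_{ν,P}[ w*(s,a) ( r(s,a) + γ ρ(s,a,s'; v, β, ζ*) − q(s,a) ) ] = (1−γ) ∫ V^π_{P*} dd₁. -/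
open MeasureTheory ProbabilityTheory

/-- `τ(s,a) := 1/(1+Λ(s,a))`. -/
noncomputable def tauOf {Z : Type*} (Λ : Z → ℝ) (z : Z) : ℝ := (1 + Λ z)⁻¹

/-- `λ(s,a) := 1 − Λ(s,a)⁻¹`. -/
noncomputable def lamOf {Z : Type*} (Λ : Z → ℝ) (z : Z) : ℝ := 1 - (Λ z)⁻¹

/-- `v(s) := ∫ q(s,a) π(da|s)`. -/
noncomputable def vOf {S A : Type*} [MeasurableSpace S] [MeasurableSpace A]
    (π : Kernel S A) (q : S × A → ℝ) (s : S) : ℝ :=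
  ∫ a, q (s, a) ∂(π s)

/-- `ρ` with decoupled indicator:
`ρ(s,a,s'; v, β, ζ) = (1−λ) v(s') + λ (β(s,a) + τ⁻¹ (v(s') − β(s,a)) 1[ζ(s,a,s') ≤ 0])`. -/
noncomputable def rhoZeta {S A : Type*} (Λ : S × A → ℝ) (v : S → ℝ) (β : S × A → ℝ)
    (ζ : S × A → S → ℝ) (sa : S × A) (s' : S) : ℝ :=
  (1 - lamOf Λ sa) * v s' +
    lamOf Λ sa * (β sa + (tauOf Λ sa)⁻¹ * (v s' - β sa) * (if ζ sa s' ≤ 0 then 1 else 0))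

/-- One step of the state-action chain under transition kernel `K` and policy `π`. -/
noncomputable def stepKernel {S A : Type*} [MeasurableSpace S] [MeasurableSpace A]
    (K : Kernel (S × A) S) (π : Kernel S A) : Kernel (S × A) (S × A) :=
  (Kernel.id ×ₖ π) ∘ₖ K

/-- `t`-fold iterate of a kernel. -/
noncomputable def iterKernel {Z : Type*} [MeasurableSpace Z] (K : Kernel Z Z) :
    ℕ → Kernel Z Z
  | 0 => Kernel.id
  | n + 1 => K ∘ₖ iterKernel K n

/-- Q-function: `Q^π_K(s,a) = Σ_t γ^t E[r(s_t,a_t)]` for the chain started at `(s,a)`. -/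
noncomputable def Qfun {S A : Type*} [MeasurableSpace S] [MeasurableSpace A]
    (K : Kernel (S × A) S) (π : Kernel S A) (r : S × A → ℝ) (γ : ℝ) (sa : S × A) : ℝ :=
  ∑' t : ℕ, γ ^ t * ∫ z, r z ∂(iterKernel (stepKernel K π) t sa)

/-- Value function `V^π_K(s) = ∫ Q^π_K(s,a) π(da|s)`. -/
noncomputable def Vfun {S A : Type*} [MeasurableSpace S] [MeasurableSpace A]
    (K : Kernel (S × A) S) (π : Kernel S A) (r : S × A → ℝ) (γ : ℝ) (s : S) : ℝ :=
  ∫ a, Qfun K π r γ (s, a) ∂(π s)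

/-- `visit d1 K π h` is the law `d^{π,h+1}_{d₁,K}` of `(s_{h+1}, a_{h+1})`. -/
noncomputable def visit {S A : Type*} [MeasurableSpace S] [MeasurableSpace A]
    (d1 : Measure S) (K : Kernel (S × A) S) (π : Kernel S A) : ℕ → Measure (S × A)
  | 0 => d1.bind (Kernel.id ×ₖ π)
  | n + 1 => (visit d1 K π n).bind (stepKernel K π)

/-- Discounted visitation distribution `d^{π,∞}_{d₁,K} = (1−γ) Σ_{h≥1} γ^{h−1} d^{π,h}`. -/
noncomputable def dvisit {S A : Type*} [MeasurableSpace S] [MeasurableSpace A]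
    (γ : ℝ) (d1 : Measure S) (K : Kernel (S × A) S) (π : Kernel S A) : Measure (S × A) :=
  Measure.sum fun h => ENNReal.ofReal ((1 - γ) * γ ^ h) • visit d1 K π h

theorem integrable_of_measurable_of_abs_le {Z : Type*} [MeasurableSpace Z] {μ : Measure Z}
    [IsFiniteMeasure μ] {f : Z → ℝ} (hf : Measurable f) {C : ℝ} (hC : ∀ z, |f z| ≤ C) :
    Integrable f μ :=
  .of_bound hf.aestronglyMeasurable C (.of_forall hC)

theorem abs_integral_le_of_abs_le {Z : Type*} [MeasurableSpace Z] {μ : Measure Z}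
    [IsProbabilityMeasure μ] {f : Z → ℝ} {C : ℝ} (hC : ∀ z, |f z| ≤ C) :
    |∫ z, f z ∂μ| ≤ C := by
  simpa using norm_integral_le_of_norm_le_const (μ := μ) (f := f) (.of_forall hC)

theorem measurable_integral_kernel {Y Z : Type*} [MeasurableSpace Y] [MeasurableSpace Z]
    (K : Kernel Y Z) {f : Z → ℝ} (hf : Measurable f) : Measurable fun y => ∫ z, f z ∂(K y) :=
  hf.stronglyMeasurable.integral_kernel.measurable

theorem integral_bind_kernel {Y Z : Type*} [MeasurableSpace Y] [MeasurableSpace Z]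
    (μ : Measure Y) [IsFiniteMeasure μ] (K : Kernel Y Z) [IsMarkovKernel K] {f : Z → ℝ}
    (hf : Measurable f) {C : ℝ} (hC : ∀ z, |f z| ≤ C) :
    ∫ z, f z ∂(μ.bind K) = ∫ y, ∫ z, f z ∂(K y) ∂μ := by
  rw [Measure.comp_eq_comp_const_apply, Kernel.integral_comp, Kernel.const_apply]
  exact integrable_of_measurable_of_abs_le hf hC

theorem integral_id_prod {S A : Type*} [MeasurableSpace S] [MeasurableSpace A]
    (π : Kernel S A) [IsMarkovKernel π] {f : S × A → ℝ} (hf : Measurable f) (s : S) :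
    ∫ z, f z ∂((Kernel.id ×ₖ π) s) = vOf π f s := by
  rw [Kernel.prod_apply, Kernel.id_apply, Measure.dirac_prod,
    integral_map measurable_prodMk_left.aemeasurable hf.aestronglyMeasurable, vOf]

theorem measurable_vOf {S A : Type*} [MeasurableSpace S] [MeasurableSpace A]
    (π : Kernel S A) [IsMarkovKernel π] {f : S × A → ℝ} (hf : Measurable f) :
    Measurable (vOf π f) := by
  simpa only [integral_id_prod π hf] using measurable_integral_kernel (Kernel.id ×ₖ π) hf

theorem abs_vOf_le {S A : Type*} [MeasurableSpace S] [MeasurableSpace A]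
    (π : Kernel S A) [IsMarkovKernel π] {f : S × A → ℝ} {C : ℝ} (hC : ∀ z, |f z| ≤ C) (s : S) :
    |vOf π f s| ≤ C :=
  abs_integral_le_of_abs_le fun a => hC (s, a)

instance isMarkovKernel_stepKernel {S A : Type*} [MeasurableSpace S] [MeasurableSpace A]
    (K : Kernel (S × A) S) [IsMarkovKernel K] (π : Kernel S A) [IsMarkovKernel π] :
    IsMarkovKernel (stepKernel K π) := by
  unfold stepKernel
  infer_instance

instance isMarkovKernel_iterKernel {Z : Type*} [MeasurableSpace Z] (K : Kernel Z Z)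
    [IsMarkovKernel K] (n : ℕ) : IsMarkovKernel (iterKernel K n) := by
  induction n with
  | zero => unfold iterKernel; infer_instance
  | succ n ih => unfold iterKernel; infer_instance

theorem integral_stepKernel {S A : Type*} [MeasurableSpace S] [MeasurableSpace A]
    (K : Kernel (S × A) S) [IsMarkovKernel K] (π : Kernel S A) [IsMarkovKernel π]
    {f : S × A → ℝ} (hf : Measurable f) {C : ℝ} (hC : ∀ z, |f z| ≤ C) (z : S × A) :
    ∫ y, f y ∂(stepKernel K π z) = ∫ s, vOf π f s ∂(K z) := by
  rw [stepKernel, Kernel.integral_comp]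
  · simp only [integral_id_prod π hf]
  · exact integrable_of_measurable_of_abs_le hf hC

theorem visit_eq_bind_iterKernel {S A : Type*} [MeasurableSpace S] [MeasurableSpace A]
    (d1 : Measure S) (K : Kernel (S × A) S) (π : Kernel S A) (n : ℕ) :
    visit d1 K π n = (visit d1 K π 0).bind (iterKernel (stepKernel K π) n) := by
  induction n with
  | zero => simp [iterKernel]
  | succ n ih =>
    change (visit d1 K π n).bind (stepKernel K π) = _
    rw [ih, iterKernel, Measure.comp_assoc]

section Visit

variable {S A : Type*} [MeasurableSpace S] [MeasurableSpace A]
  (d1 : Measure S) [IsProbabilityMeasure d1] (K : Kernel (S × A) S)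
  (π : Kernel S A) [IsMarkovKernel π]

theorem integral_visit_zero {f : S × A → ℝ} (hf : Measurable f) {C : ℝ} (hC : ∀ z, |f z| ≤ C) :
    ∫ z, f z ∂(visit d1 K π 0) = ∫ s, vOf π f s ∂d1 := by
  rw [visit, integral_bind_kernel _ _ hf hC]
  simp only [integral_id_prod π hf]

variable [IsMarkovKernel K]

instance isProbabilityMeasure_visit (n : ℕ) : IsProbabilityMeasure (visit d1 K π n) := by
  induction n with
  | zero => unfold visit; infer_instance
  | succ n ih => unfold visit; infer_instance

theorem integral_visit_succ {f : S × A → ℝ} (hf : Measurable f) {C : ℝ} (hC : ∀ z, |f z| ≤ C)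
    (n : ℕ) :
    ∫ z, f z ∂(visit d1 K π (n + 1)) = ∫ z, ∫ s, vOf π f s ∂(K z) ∂(visit d1 K π n) := by
  rw [visit, integral_bind_kernel _ _ hf hC]
  simp only [integral_stepKernel K π hf hC]

theorem isFiniteMeasure_dvisit {γ : ℝ} (hγ : γ ∈ Set.Ico (0 : ℝ) 1) :
    IsFiniteMeasure (dvisit γ d1 K π) := by
  have hsum : Summable fun h : ℕ => (1 - γ) * γ ^ h :=
    (summable_geometric_of_lt_one hγ.1 hγ.2).mul_left _
  refine ⟨?_⟩
  simp only [dvisit, Measure.sum_apply _ MeasurableSet.univ, Measure.smul_apply, measure_univ,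
    smul_eq_mul, mul_one]
  rw [← ENNReal.ofReal_tsum_of_nonneg
    (fun h => mul_nonneg (sub_nonneg.2 hγ.2.le) (pow_nonneg hγ.1 h)) hsum]
  exact ENNReal.ofReal_lt_top

theorem hasSum_integral_dvisit {γ : ℝ} (hγ : γ ∈ Set.Ico (0 : ℝ) 1)
    {f : S × A → ℝ} (hf : Measurable f) {C : ℝ} (hC : ∀ z, |f z| ≤ C) :
    HasSum (fun h => (1 - γ) * γ ^ h * ∫ z, f z ∂(visit d1 K π h))
      (∫ z, f z ∂(dvisit γ d1 K π)) := by
  have := isFiniteMeasure_dvisit d1 K π hγ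
  have hint : Integrable f (dvisit γ d1 K π) := integrable_of_measurable_of_abs_le hf hC
  have hterm : ∀ h, ∫ z, f z ∂(ENNReal.ofReal ((1 - γ) * γ ^ h) • visit d1 K π h)
      = (1 - γ) * γ ^ h * ∫ z, f z ∂(visit d1 K π h) := fun h => by
    rw [integral_smul_measure, ENNReal.toReal_ofReal
      (mul_nonneg (sub_nonneg.2 hγ.2.le) (pow_nonneg hγ.1 h)), smul_eq_mul]
  simp only [← hterm]
  exact hasSum_integral_measure hint

/-- The Bellman flow equation for the discounted visitation distribution. -/
theorem integral_dvisit_eq_add {γ : ℝ} (hγ : γ ∈ Set.Ico (0 : ℝ) 1)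
    {f : S × A → ℝ} (hf : Measurable f) {C : ℝ} (hC : ∀ z, |f z| ≤ C) :
    ∫ z, f z ∂(dvisit γ d1 K π) = (1 - γ) * ∫ s, vOf π f s ∂d1 +
      γ * ∫ z, ∫ s, vOf π f s ∂(K z) ∂(dvisit γ d1 K π) := by
  have hsum := hasSum_integral_dvisit d1 K π hγ hf hC
  have hnext := (hasSum_integral_dvisit d1 K π hγ
    (measurable_integral_kernel K (measurable_vOf π hf))
    (fun z => abs_integral_le_of_abs_le (μ := K z) (abs_vOf_le π hC))).mul_left γ
  rw [← hsum.tsum_eq, hsum.summable.tsum_eq_zero_add, ← hnext.tsum_eq,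
    integral_visit_zero d1 K π hf hC]
  simp only [integral_visit_succ d1 K π hf hC, pow_zero, mul_one]
  congr 2 with h
  ring

theorem integral_dvisit_eq_integral_Vfun {γ : ℝ} (hγ : γ ∈ Set.Ico (0 : ℝ) 1)
    {f : S × A → ℝ} (hf : Measurable f) {C : ℝ} (hC : ∀ z, |f z| ≤ C) :
    ∫ z, f z ∂(dvisit γ d1 K π) = (1 - γ) * ∫ s, Vfun K π f γ s ∂d1 := by
  set T := stepKernel K π
  have hmeas : ∀ t, Measurable fun z => γ ^ t * ∫ y, f y ∂(iterKernel T t z) := fun t =>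
    (measurable_integral_kernel _ hf).const_mul _
  have hbound : ∀ t z, |γ ^ t * ∫ y, f y ∂(iterKernel T t z)| ≤ γ ^ t * C := fun t z => by
    rw [abs_mul, abs_of_nonneg (pow_nonneg hγ.1 t)]
    exact mul_le_mul_of_nonneg_left (abs_integral_le_of_abs_le hC) (pow_nonneg hγ.1 t)
  have hgeom : Summable fun t : ℕ => γ ^ t * C :=
    (summable_geometric_of_lt_one hγ.1 hγ.2).mul_right _
  have hQ_meas : Measurable (Qfun K π f γ) := Measurable.tsum hmeas
  have hQ_bound : ∀ z, |Qfun K π f γ z| ≤ ∑' t : ℕ, γ ^ t * C := fun z => by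
    rw [← Real.norm_eq_abs]
    exact tsum_of_norm_bounded hgeom.hasSum fun t => hbound t z
  have hQ : ∫ z, Qfun K π f γ z ∂(visit d1 K π 0)
      = ∑' t : ℕ, γ ^ t * ∫ z, f z ∂(visit d1 K π t) := by
    have hswap := hasSum_integral_of_summable_integral_norm (μ := visit d1 K π 0)
      (fun t => integrable_of_measurable_of_abs_le (hmeas t) (hbound t))
      (hgeom.of_nonneg_of_le (fun t => integral_nonneg fun z => norm_nonneg _)
        fun t => (le_abs_self _).trans
          (abs_integral_le_of_abs_le fun z => (abs_norm _).trans_le (hbound t z)))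
    refine hswap.tsum_eq.symm.trans (tsum_congr fun t => ?_)
    rw [integral_const_mul, visit_eq_bind_iterKernel d1 K π t, integral_bind_kernel _ _ hf hC]
  have hV : ∫ s, Vfun K π f γ s ∂d1 = ∫ z, Qfun K π f γ z ∂(visit d1 K π 0) :=
    (integral_visit_zero d1 K π hQ_meas hQ_bound).symm
  rw [hV, hQ, ← (hasSum_integral_dvisit d1 K π hγ hf hC).tsum_eq, ← tsum_mul_left]
  simp only [mul_assoc]

end Visit

theorem lamOf_nonneg {Z : Type*} {Λ : Z → ℝ} {z : Z} (h : 1 ≤ Λ z) : 0 ≤ lamOf Λ z :=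
  sub_nonneg.2 (inv_le_one_of_one_le₀ h)

theorem tauOf_pos {Z : Type*} {Λ : Z → ℝ} {z : Z} (h : 1 ≤ Λ z) : 0 < tauOf Λ z :=
  inv_pos.2 (by linarith)

/-- The density of `P*` with respect to `P`. -/
noncomputable def tiltDensity {S A : Type*} (Λ : S × A → ℝ)
    (ζ : S × A → S → ℝ) (sa : S × A) (s' : S) : ℝ :=
  (1 - lamOf Λ sa) + lamOf Λ sa * (tauOf Λ sa)⁻¹ * (if ζ sa s' ≤ 0 then 1 else 0)

theorem tiltDensity_nonneg {S A : Type*} {Λ : S × A → ℝ} {ζ : S × A → S → ℝ} {sa : S × A}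
    (h : 1 ≤ Λ sa) (s' : S) : 0 ≤ tiltDensity Λ ζ sa s' := by
  have hl : 0 ≤ 1 - lamOf Λ sa := by
    rw [lamOf, sub_sub_cancel]
    exact inv_nonneg.2 (by linarith)
  refine add_nonneg hl (mul_nonneg (mul_nonneg (lamOf_nonneg h) (inv_nonneg.2 (tauOf_pos h).le)) ?_)
  split_ifs <;> norm_num

theorem abs_indicator_nonpos_le {S A : Type*} {ζ : S × A → S → ℝ} (sa : S × A) (s' : S) :
    |if ζ sa s' ≤ 0 then (1 : ℝ) else 0| ≤ 1 := by
  split_ifs <;> norm_num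

section Reweighting

variable {S A : Type*} [MeasurableSpace S] [MeasurableSpace A]
  (P : Kernel (S × A) S) {Λ : S × A → ℝ} {ζ : S × A → S → ℝ}

theorem measurable_tiltDensity (hΛ : Measurable Λ) (hζ : Measurable (Function.uncurry ζ)) :
    Measurable (Function.uncurry (tiltDensity Λ ζ)) := by
  have hl : Measurable (lamOf Λ) := hΛ.inv.const_sub 1
  have ht : Measurable (tauOf Λ) := (hΛ.const_add 1).inv
  have hind : Measurable fun p : (S × A) × S => if Function.uncurry ζ p ≤ 0 then (1 : ℝ) else 0 :=
    Measurable.ite (measurableSet_le hζ measurable_const) measurable_const measurable_const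
  exact ((hl.comp measurable_fst).const_sub 1).add
    (((hl.comp measurable_fst).mul (ht.comp measurable_fst).inv).mul hind)

theorem measurable_indicator_nonpos (hζ : Measurable (Function.uncurry ζ)) (sa : S × A) :
    Measurable fun s' => if ζ sa s' ≤ 0 then (1 : ℝ) else 0 :=
  Measurable.ite (measurableSet_le (hζ.comp measurable_prodMk_left) measurable_const)
    measurable_const measurable_const

theorem integral_indicator_nonpos (hζ : Measurable (Function.uncurry ζ)) {sa : S × A}
    (h : 1 ≤ Λ sa) (hq : P sa {s' | ζ sa s' ≤ 0} = ENNReal.ofReal (tauOf Λ sa)) :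
    ∫ s', (if ζ sa s' ≤ 0 then (1 : ℝ) else 0) ∂(P sa) = tauOf Λ sa := by
  have hset : MeasurableSet {s' | ζ sa s' ≤ 0} :=
    measurableSet_le (hζ.comp measurable_prodMk_left) measurable_const
  have heq : (fun s' => if ζ sa s' ≤ 0 then (1 : ℝ) else 0)
      = {s' | ζ sa s' ≤ 0}.indicator 1 := by
    ext s'
    simp [Set.indicator_apply]
  rw [heq, integral_indicator_one hset, measureReal_def, hq, ENNReal.toReal_ofReal (tauOf_pos h).le]

variable [IsMarkovKernel P]

theorem integral_withDensity_tiltDensity (hΛ : Measurable Λ) (hζ : Measurable (Function.uncurry ζ))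
    {sa : S × A} (h : 1 ≤ Λ sa) (g : S → ℝ) :
    ∫ s', g s' ∂(Kernel.withDensity P (fun sa s' => ENNReal.ofReal (tiltDensity Λ ζ sa s')) sa)
      = ∫ s', tiltDensity Λ ζ sa s' * g s' ∂(P sa) := by
  have hmeas := measurable_tiltDensity hΛ hζ
  have hmeas_ofReal : Measurable (Function.uncurry fun sa s' =>
    ENNReal.ofReal (tiltDensity Λ ζ sa s')) := hmeas.ennreal_ofReal
  rw [Kernel.withDensity_apply P hmeas_ofReal, integral_withDensity_eq_integral_toReal_smul
    hmeas_ofReal.of_uncurry_left (.of_forall fun _ => ENNReal.ofReal_lt_top)]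
  simp only [ENNReal.toReal_ofReal (tiltDensity_nonneg h _), smul_eq_mul]

theorem isMarkovKernel_withDensity_tiltDensity (hΛ : Measurable Λ)
    (hζ : Measurable (Function.uncurry ζ)) (h : ∀ sa, 1 ≤ Λ sa)
    (hq : ∀ sa, P sa {s' | ζ sa s' ≤ 0} = ENNReal.ofReal (tauOf Λ sa)) :
    IsMarkovKernel
      (Kernel.withDensity P fun sa s' => ENNReal.ofReal (tiltDensity Λ ζ sa s')) := by
  refine ⟨fun sa => ⟨?_⟩⟩
  have hmeas := measurable_tiltDensity hΛ hζ
  have hmeas_ofReal : Measurable (Function.uncurry fun sa s' =>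
    ENNReal.ofReal (tiltDensity Λ ζ sa s')) := hmeas.ennreal_ofReal
  have hind : Integrable (fun s' => if ζ sa s' ≤ 0 then (1 : ℝ) else 0) (P sa) :=
    integrable_of_measurable_of_abs_le (measurable_indicator_nonpos hζ sa)
      (abs_indicator_nonpos_le sa)
  have hint : Integrable (tiltDensity Λ ζ sa) (P sa) :=
    (integrable_const _).add (hind.const_mul _)
  have hone : ∫ s', tiltDensity Λ ζ sa s' ∂(P sa) = 1 := by
    simp only [tiltDensity]
    rw [integral_add (integrable_const _) (hind.const_mul _), integral_const_mul,
      integral_indicator_nonpos P hζ (h sa) (hq sa), mul_assoc,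
      inv_mul_cancel₀ (tauOf_pos (h sa)).ne']
    simp
  rw [Kernel.withDensity_apply P hmeas_ofReal, withDensity_apply _ MeasurableSet.univ,
    Measure.restrict_univ, ← ofReal_integral_eq_lintegral_ofReal hint
      (.of_forall (tiltDensity_nonneg (h sa))), hone, ENNReal.ofReal_one]

/-- The baseline `β` cancels in expectation, leaving the expectation of `v` under `P*`. -/
theorem integral_rhoZeta (hΛ : Measurable Λ) (hζ : Measurable (Function.uncurry ζ)) {sa : S × A}
    (h : 1 ≤ Λ sa) (hq : P sa {s' | ζ sa s' ≤ 0} = ENNReal.ofReal (tauOf Λ sa))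
    {v : S → ℝ} (hv : Measurable v) {C : ℝ} (hC : ∀ s, |v s| ≤ C) (β : S × A → ℝ) :
    Integrable (rhoZeta Λ v β ζ sa) (P sa) ∧ ∫ s', rhoZeta Λ v β ζ sa s' ∂(P sa) =
      ∫ s', v s' ∂(Kernel.withDensity P
        (fun sa s' => ENNReal.ofReal (tiltDensity Λ ζ sa s')) sa) := by
  have hind : Integrable (fun s' => if ζ sa s' ≤ 0 then (1 : ℝ) else 0) (P sa) :=
    integrable_of_measurable_of_abs_le (measurable_indicator_nonpos hζ sa)
      (abs_indicator_nonpos_le sa)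
  have hv_int : Integrable v (P sa) := integrable_of_measurable_of_abs_le hv hC
  have hvind : Integrable (fun s' => v s' * if ζ sa s' ≤ 0 then (1 : ℝ) else 0) (P sa) :=
    hv_int.mul_bdd (measurable_indicator_nonpos hζ sa).aestronglyMeasurable
      (.of_forall (abs_indicator_nonpos_le sa))
  have htilt : Integrable (fun s' => tiltDensity Λ ζ sa s' * v s') (P sa) := by
    refine ((hv_int.const_mul (1 - lamOf Λ sa)).add
      (hvind.const_mul (lamOf Λ sa * (tauOf Λ sa)⁻¹))).congr (.of_forall fun s' => ?_)
    simp only [tiltDensity, Pi.add_apply]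
    ring
  have hdecomp : rhoZeta Λ v β ζ sa = fun s' => tiltDensity Λ ζ sa s' * v s' +
      (lamOf Λ sa * β sa - lamOf Λ sa * β sa * (tauOf Λ sa)⁻¹ *
        (if ζ sa s' ≤ 0 then (1 : ℝ) else 0)) := by
    ext s'
    simp only [rhoZeta, tiltDensity]
    ring
  have hbase : Integrable (fun s' => lamOf Λ sa * β sa - lamOf Λ sa * β sa * (tauOf Λ sa)⁻¹ *
      (if ζ sa s' ≤ 0 then (1 : ℝ) else 0)) (P sa) :=
    (integrable_const _).sub (hind.const_mul _)
  rw [integral_withDensity_tiltDensity P hΛ hζ h, hdecomp]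
  refine ⟨htilt.add hbase, ?_⟩
  rw [integral_add htilt hbase, integral_sub (integrable_const _) (hind.const_mul _),
    integral_const, integral_const_mul, integral_indicator_nonpos P hζ h hq, mul_assoc (_ * _),
    inv_mul_cancel₀ (tauOf_pos h).ne']
  simp

end Reweighting

/-- Sharpness with correct `w*` and `ζ*`: with `P*` the reweighting of `P` by the density
`(1−λ) + λ τ⁻¹ 1[ζ* ≤ 0]` (where `ζ*` cuts mass exactly `τ(s,a)`), and `w*` the bounded
density of the discounted visitation `d* = d^{π,∞}_{d₁,P*}` w.r.t. `ν`, we have for all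
bounded measurable `q, β`:
`(1−γ) ∫ v dd₁ + E_{ν,P}[w*(s,a)(r(s,a) + γ ρ(s,a,s';v,β,ζ*) − q(s,a))] = (1−γ) ∫ V^π_{P*} dd₁`. -/
theorem sharpness_correct_w_zeta
    {S A : Type*} [MeasurableSpace S] [MeasurableSpace A]
    (P : Kernel (S × A) S) [IsMarkovKernel P] (π : Kernel S A) [IsMarkovKernel π]
    (r : S × A → ℝ) (hr_meas : Measurable r) (hr_bdd : ∀ z, r z ∈ Set.Icc (0 : ℝ) 1)
    (γ : ℝ) (hγ : γ ∈ Set.Ico (0 : ℝ) 1)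
    (d1 : Measure S) [IsProbabilityMeasure d1]
    (ν : Measure (S × A)) [IsProbabilityMeasure ν]
    (Λ : S × A → ℝ) (hΛ_meas : Measurable Λ) (hΛ_lb : ∀ sa, 1 ≤ Λ sa)
    (MΛ : ℝ) (hΛ_ub : ∀ sa, Λ sa ≤ MΛ)
    (ζ : S × A → S → ℝ) (hζ_meas : Measurable (Function.uncurry ζ))
    (hζ_quantile : ∀ sa, P sa {s' | ζ sa s' ≤ 0} = ENNReal.ofReal (tauOf Λ sa))
    (Pstar : Kernel (S × A) S)
    (hPstar : Pstar = Kernel.withDensity P fun sa s' =>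
      ENNReal.ofReal ((1 - lamOf Λ sa) +
        lamOf Λ sa * (tauOf Λ sa)⁻¹ * (if ζ sa s' ≤ 0 then 1 else 0)))
    (wstar : S × A → ℝ) (hw_meas : Measurable wstar) (hw_nonneg : ∀ sa, 0 ≤ wstar sa)
    (Mw : ℝ) (hw_bdd : ∀ sa, wstar sa ≤ Mw)
    (hw_density :
      ν.withDensity (fun sa => ENNReal.ofReal (wstar sa)) = dvisit γ d1 Pstar π)
    (q β : S × A → ℝ) (hq_meas : Measurable q) (hβ_meas : Measurable β)
    (Mq : ℝ) (hq_bdd : ∀ sa, |q sa| ≤ Mq) (Mβ : ℝ) (hβ_bdd : ∀ sa, |β sa| ≤ Mβ) :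
    (1 - γ) * (∫ s, vOf π q s ∂d1) +
      (∫ sa, ∫ s',
        wstar sa * (r sa + γ * rhoZeta Λ (vOf π q) β ζ sa s' - q sa) ∂(P sa) ∂ν) =
      (1 - γ) * ∫ s, Vfun Pstar π r γ s ∂d1 := by
  have hP : Pstar = Kernel.withDensity P
      fun sa s' => ENNReal.ofReal (tiltDensity Λ ζ sa s') := hPstar
  have hmarkov : IsMarkovKernel Pstar :=
    hP ▸ isMarkovKernel_withDensity_tiltDensity P hΛ_meas hζ_meas hΛ_lb hζ_quantile
  have hv_meas := measurable_vOf π hq_meas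
  have hv_bdd := abs_vOf_le π hq_bdd
  have hr_abs : ∀ z, |r z| ≤ 1 := fun z => abs_le.2 ⟨by linarith [(hr_bdd z).1], (hr_bdd z).2⟩
  have hinner : ∀ sa, ∫ s', wstar sa * (r sa + γ * rhoZeta Λ (vOf π q) β ζ sa s' - q sa) ∂(P sa)
      = wstar sa * (r sa + γ * ∫ s, vOf π q s ∂(Pstar sa) - q sa) := fun sa => by
    obtain ⟨hint, heq⟩ := integral_rhoZeta P hΛ_meas hζ_meas (hΛ_lb sa) (hζ_quantile sa)
      hv_meas hv_bdd β
    have hsum : Integrable (fun s' => r sa + γ * rhoZeta Λ (vOf π q) β ζ sa s') (P sa) :=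
      (integrable_const _).add (hint.const_mul γ)
    rw [integral_const_mul, integral_sub hsum (integrable_const _),
      integral_add (integrable_const _) (hint.const_mul γ),
      integral_const_mul, heq, hP]
    simp
  have hdens : ∀ g : S × A → ℝ, ∫ sa, wstar sa * g sa ∂ν = ∫ sa, g sa ∂(dvisit γ d1 Pstar π) :=
    fun g => by
      rw [← hw_density, integral_withDensity_eq_integral_toReal_smul hw_meas.ennreal_ofReal
        (.of_forall fun _ => ENNReal.ofReal_lt_top)]
      simp only [ENNReal.toReal_ofReal (hw_nonneg _), smul_eq_mul]
  have := isFiniteMeasure_dvisit d1 Pstar π hγ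
  have hr_int : Integrable r (dvisit γ d1 Pstar π) :=
    integrable_of_measurable_of_abs_le hr_meas hr_abs
  have hq_int : Integrable q (dvisit γ d1 Pstar π) :=
    integrable_of_measurable_of_abs_le hq_meas hq_bdd
  have hv_int : Integrable (fun sa => ∫ s, vOf π q s ∂(Pstar sa)) (dvisit γ d1 Pstar π) :=
    integrable_of_measurable_of_abs_le (measurable_integral_kernel Pstar hv_meas)
      fun sa => abs_integral_le_of_abs_le hv_bdd
  simp only [hinner]
  have hsum_int : Integrable (fun sa => r sa + γ * ∫ s, vOf π q s ∂(Pstar sa))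
      (dvisit γ d1 Pstar π) := hr_int.add (hv_int.const_mul γ)
  rw [hdens, integral_sub hsum_int hq_int,
    integral_add hr_int (hv_int.const_mul γ), integral_const_mul,
    integral_dvisit_eq_add d1 Pstar π hγ hq_meas hq_bdd,
    integral_dvisit_eq_integral_Vfun d1 Pstar π hγ hr_meas hr_abs]
  ring
end

section
/- Let Z be a measurable space, P a probability measure on Z, f : Z → ℝ bounded measurable, and τ ∈ (0,1). Suppose β_τ ∈ ℝ is the unique maximizer of b ↦ b + τ⁻¹ ∫ min(f(z) − b, 0) dP(z), and P(f ≤ β_τ) = τ. Fix z̄ ∈ Z and for ε ∈ [0,1) set P_ε := (1−ε)P + ε δ_{z̄}. Then the map ε ↦ CVaR⁻_τ(f; P_ε) has right derivative at ε = 0 equal to β_τ + τ⁻¹ min( f(z̄) − β_τ, 0 ) − CVaR⁻_τ(f; P). -/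
open MeasureTheory

/-- Lower conditional value-at-risk at level `τ`. -/
noncomputable def cvarLower {Z : Type*} [MeasurableSpace Z] (τ : ℝ) (f : Z → ℝ)
    (μ : Measure Z) : ℝ :=
  ⨆ b : ℝ, b + τ⁻¹ * ∫ z, min (f z - b) 0 ∂μ

open Filter Topology

/-- A concave function on `ℝ` with a strict global maximum at `β` decays at least linearly away
from any neighbourhood of `β`. -/
lemma ConcaveOn.exists_le_sub_mul_abs_of_strict_max {φ : ℝ → ℝ} (hφ : ConcaveOn ℝ Set.univ φ)
    {β : ℝ} (hmax : ∀ b, b ≠ β → φ b < φ β) {δ : ℝ} (hδ : 0 < δ) :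
    ∃ c > 0, ∀ b, δ ≤ |b - β| → φ b ≤ φ β - c * |b - β| := by
  have hright : φ (β + δ) < φ β := hmax _ (by simp [hδ.ne'])
  have hleft : φ (β - δ) < φ β := hmax _ (by simp [hδ.ne'])
  refine ⟨min (φ β - φ (β + δ)) (φ β - φ (β - δ)) / δ,
    div_pos (lt_min (by linarith) (by linarith)) hδ, fun b hb => ?_⟩
  set c := min (φ β - φ (β + δ)) (φ β - φ (β - δ)) / δ
  have hcδ : c * δ = min (φ β - φ (β + δ)) (φ β - φ (β - δ)) := div_mul_cancel₀ _ hδ.ne'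
  have hpos : 0 < |b - β| := hδ.trans_le hb
  set s := δ / |b - β|
  have hs_pos : 0 < s := div_pos hδ hpos
  have hs_le : s ≤ 1 := (div_le_one hpos).2 hb
  have hs_mul : s * |b - β| = δ := div_mul_cancel₀ _ hpos.ne'
  have hconc : (1 - s) * φ β + s * φ b ≤ φ ((1 - s) * β + s * b) :=
    hφ.2 (Set.mem_univ β) (Set.mem_univ b) (sub_nonneg.2 hs_le) hs_pos.le (by ring)
  have hpoint : φ ((1 - s) * β + s * b) ≤ φ β - c * δ := by
    rcases abs_cases (b - β) with ⟨h, -⟩ | ⟨h, -⟩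
    · rw [show (1 - s) * β + s * b = β + δ by rw [← hs_mul, h]; ring, hcδ]
      linarith [min_le_left (φ β - φ (β + δ)) (φ β - φ (β - δ))]
    · rw [show (1 - s) * β + s * b = β - δ by rw [← hs_mul, h]; ring, hcδ]
      linarith [min_le_right (φ β - φ (β + δ)) (φ β - φ (β - δ))]
  have hscaled : s * φ b ≤ s * (φ β - c * |b - β|) := by
    have : s * (φ β - c * |b - β|) = s * φ β - c * δ := by rw [← hs_mul]; ring
    linarith
  exact le_of_mul_le_mul_left hscaled hs_pos

/-- Envelope theorem: if `φ` is concave with a strict global maximum at `β` and `g` grows at most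
linearly from `β`, the value function of the mixture `(1 - ε) φ + ε g` has right derivative
`g β - φ β` at `0`. -/
lemma hasDerivWithinAt_iSup_mixture {φ g : ℝ → ℝ} (hφ : ConcaveOn ℝ Set.univ φ)
    {β : ℝ} (hmax : ∀ b, b ≠ β → φ b < φ β) {L : ℝ} (hL : 0 < L)
    (hg : ∀ b, g b ≤ g β + L * |b - β|) :
    HasDerivWithinAt (fun ε : ℝ => ⨆ b, ((1 - ε) * φ b + ε * g b)) (g β - φ β)
      (Set.Ici 0) 0 := by
  have hle : ∀ b, φ b ≤ φ β := fun b => by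
    rcases eq_or_ne b β with rfl | hb
    exacts [le_rfl, (hmax b hb).le]
  have hzero : (⨆ b, ((1 - (0 : ℝ)) * φ b + 0 * g b)) = φ β := by
    simp only [sub_zero, one_mul, zero_mul, add_zero]
    exact le_antisymm (ciSup_le hle) (le_ciSup ⟨φ β, Set.forall_mem_range.2 hle⟩ β)
  rw [hasDerivWithinAt_iff_isLittleO, Asymptotics.isLittleO_iff]
  intro η hη
  obtain ⟨c, hc, hdecay⟩ := hφ.exists_le_sub_mul_abs_of_strict_max hmax (div_pos hη hL)
  have hsmall : ∀ᶠ ε : ℝ in 𝓝[Set.Ici 0] 0, ε < c / (L + c) :=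
    nhdsWithin_le_nhds (Iio_mem_nhds (by positivity))
  filter_upwards [hsmall, self_mem_nhdsWithin] with ε hε hε0
  replace hε0 : 0 ≤ ε := hε0
  rw [lt_div_iff₀ (by positivity)] at hε
  have hε1 : ε ≤ 1 := by nlinarith
  have hupper : ∀ b, (1 - ε) * φ b + ε * g b ≤ (1 - ε) * φ β + ε * g β + η * ε := fun b => by
    have hgb := mul_le_mul_of_nonneg_left (hg b) hε0
    rcases le_total (η / L) |b - β| with hb | hb
    · have hφb := mul_le_mul_of_nonneg_left (hdecay b hb) (sub_nonneg.2 hε1)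
      have hslope : (ε * (L + c) - c) * |b - β| ≤ 0 :=
        mul_nonpos_of_nonpos_of_nonneg (by linarith) (abs_nonneg _)
      have : 0 ≤ η * ε := by positivity
      linarith
    · have hφb := mul_le_mul_of_nonneg_left (hle b) (sub_nonneg.2 hε1)
      rw [le_div_iff₀ hL] at hb
      have := mul_le_mul_of_nonneg_left hb hε0
      linarith
  have hsup_le := ciSup_le hupper
  have hle_sup : (1 - ε) * φ β + ε * g β ≤ ⨆ b, ((1 - ε) * φ b + ε * g b) :=
    le_ciSup (f := fun b => (1 - ε) * φ b + ε * g b) ⟨_, Set.forall_mem_range.2 hupper⟩ β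
  rw [hzero, sub_zero, Real.norm_eq_abs, Real.norm_eq_abs, abs_of_nonneg hε0, smul_eq_mul, abs_le]
  have : 0 ≤ η * ε := by positivity
  constructor <;> linarith

section

variable {Z : Type*} [MeasurableSpace Z] {μ : Measure Z} [IsFiniteMeasure μ] {f : Z → ℝ}

lemma integrable_min_sub_zero (hf : Integrable f μ) (b : ℝ) :
    Integrable (fun z => min (f z - b) 0) μ :=
  (hf.sub (integrable_const b)).inf (integrable_const 0)

/-- The objective in the variational formula for `cvarLower` is concave. -/
lemma concaveOn_cvarLower_objective (hf : Integrable f μ) {τ : ℝ} (hτ : 0 ≤ τ) :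
    ConcaveOn ℝ Set.univ (fun b : ℝ => b + τ⁻¹ * ∫ z, min (f z - b) 0 ∂μ) := by
  refine ⟨convex_univ, fun x _ y _ s t hs ht hst => ?_⟩
  have hint : s * ∫ z, min (f z - x) 0 ∂μ + t * ∫ z, min (f z - y) 0 ∂μ
      ≤ ∫ z, min (f z - (s * x + t * y)) 0 ∂μ := by
    have hx := (integrable_min_sub_zero hf x).const_mul s
    have hy := (integrable_min_sub_zero hf y).const_mul t
    rw [← integral_const_mul, ← integral_const_mul, ← integral_add hx hy]
    refine integral_mono (hx.add hy) (integrable_min_sub_zero hf _) fun z => ?_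
    have hx1 := mul_le_mul_of_nonneg_left (min_le_left (f z - x) 0) hs
    have hx0 := mul_le_mul_of_nonneg_left (min_le_right (f z - x) 0) hs
    have hy1 := mul_le_mul_of_nonneg_left (min_le_left (f z - y) 0) ht
    have hy0 := mul_le_mul_of_nonneg_left (min_le_right (f z - y) 0) ht
    have hz : f z = s * f z + t * f z := by rw [← add_mul, hst, one_mul]
    exact le_min (by linarith) (by linarith)
  have := mul_le_mul_of_nonneg_left hint (inv_nonneg.2 hτ)
  simp only [smul_eq_mul]
  linarith

end

lemma add_mul_min_sub_le_add_abs {a : ℝ} (ha : 0 ≤ a) (x b β : ℝ) :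
    b + a * min (x - b) 0 ≤ β + a * min (x - β) 0 + (1 + a) * |b - β| := by
  have hmin : min (x - b) 0 ≤ min (x - β) 0 + |b - β| := by
    rw [← min_add_add_right]
    have := neg_abs_le (b - β)
    exact min_le_min (by linarith) (by linarith [abs_nonneg (b - β)])
  have := mul_le_mul_of_nonneg_left hmin ha
  linarith [le_abs_self (b - β)]

/-- Influence-function computation for the lower CVaR: if `β_τ` is the unique maximizer of
`b ↦ b + τ⁻¹ ∫ min(f − b, 0) dP` and `P(f ≤ β_τ) = τ`, then `ε ↦ CVaR⁻_τ(f; (1−ε)P + ε δ_{z0})`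
has right derivative at `ε = 0` equal to
`β_τ + τ⁻¹ min(f(z0) − β_τ, 0) − CVaR⁻_τ(f; P)`. -/
theorem cvar_dirac_right_derivative
    {Z : Type*} [MeasurableSpace Z] (P : Measure Z) [IsProbabilityMeasure P]
    (f : Z → ℝ) (hf_meas : Measurable f) (M : ℝ) (hf_bdd : ∀ z, |f z| ≤ M)
    (τ : ℝ) (hτ : τ ∈ Set.Ioo (0 : ℝ) 1) (βτ : ℝ)
    (hβ_max : ∀ b : ℝ,
      b + τ⁻¹ * ∫ z, min (f z - b) 0 ∂P ≤ βτ + τ⁻¹ * ∫ z, min (f z - βτ) 0 ∂P)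
    (hβ_unique : ∀ b : ℝ,
      b + τ⁻¹ * ∫ z, min (f z - b) 0 ∂P = βτ + τ⁻¹ * ∫ z, min (f z - βτ) 0 ∂P → b = βτ)
    (hβ_quantile : P {z | f z ≤ βτ} = ENNReal.ofReal τ)
    (z0 : Z) :
    HasDerivWithinAt
      (fun ε : ℝ =>
        cvarLower τ f (ENNReal.ofReal (1 - ε) • P + ENNReal.ofReal ε • Measure.dirac z0))
      (βτ + τ⁻¹ * min (f z0 - βτ) 0 - cvarLower τ f P)
      (Set.Ici (0 : ℝ)) 0 := by
  have hτ0 : 0 < τ := hτ.1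
  have hf_int : Integrable f P :=
    Integrable.of_bound hf_meas.aestronglyMeasurable M (Eventually.of_forall hf_bdd)
  have henv := hasDerivWithinAt_iSup_mixture
    (concaveOn_cvarLower_objective hf_int hτ0.le)
    (fun b hb => (hβ_max b).lt_of_ne fun h => hb (hβ_unique b h))
    (by positivity : 0 < 1 + τ⁻¹)
    (fun b => add_mul_min_sub_le_add_abs (inv_nonneg.2 hτ0.le) (f z0) b βτ)
  have hvalue : cvarLower τ f P = βτ + τ⁻¹ * ∫ z, min (f z - βτ) 0 ∂P :=
    le_antisymm (ciSup_le hβ_max)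
      (le_ciSup (f := fun b : ℝ => b + τ⁻¹ * ∫ z, min (f z - b) 0 ∂P)
        ⟨_, Set.forall_mem_range.2 hβ_max⟩ βτ)
  have hmix : ∀ ε : ℝ, 0 ≤ ε → ε ≤ 1 →
      cvarLower τ f (ENNReal.ofReal (1 - ε) • P + ENNReal.ofReal ε • Measure.dirac z0) =
        ⨆ b : ℝ, ((1 - ε) * (b + τ⁻¹ * ∫ z, min (f z - b) 0 ∂P)
          + ε * (b + τ⁻¹ * min (f z0 - b) 0)) := by
    intro ε hε0 hε1
    refine iSup_congr fun b => ?_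
    have hmeas : StronglyMeasurable fun z => min (f z - b) 0 :=
      ((hf_meas.sub_const b).min measurable_const).stronglyMeasurable
    have hdirac : Integrable (fun z => min (f z - b) 0) (Measure.dirac z0) :=
      integrable_min_sub_zero (Integrable.of_bound hf_meas.aestronglyMeasurable M
        (Eventually.of_forall hf_bdd)) b
    rw [integral_add_measure ((integrable_min_sub_zero hf_int b).smul_measure ENNReal.ofReal_ne_top)
      (hdirac.smul_measure ENNReal.ofReal_ne_top), integral_smul_measure, integral_smul_measure,
      integral_dirac' _ _ hmeas, ENNReal.toReal_ofReal (sub_nonneg.2 hε1),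
      ENNReal.toReal_ofReal hε0, smul_eq_mul, smul_eq_mul]
    ring
  rw [hvalue]
  refine henv.congr_of_eventuallyEq ?_ (hmix 0 le_rfl zero_le_one)
  filter_upwards [self_mem_nhdsWithin, nhdsWithin_le_nhds (Iic_mem_nhds one_pos)] with ε hε0 hε1
  exact hmix ε hε0 hε1
end
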